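/- Let α ∈ ℝ \ {0} and let m ∈ ℤ satisfy q^m < |α|. Then ∑_{j=−∞}^{∞} v_{m,j}² = (q;q)_∞² · α^{−2m} q^{m(m+1)} / (1 − α^{−2} q^{2m}). -/

import Mathlib

open Complex Filter Topology

/-- Finite q-Pochhammer symbol `(a;q)_n`. -/
noncomputable def qp (q a : ℂ) (n : ℕ) : ℂ := ∏ k ∈ Finset.range n, (1 - a * q ^ k)

/-- Infinite q-Pochhammer symbol `(a;q)_∞`. -/
noncomputable def qpInf (q a : ℂ) : ℂ := ∏' k : ℕ, (1 - a * q ^ k)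

/-- Regularized confluent basic hypergeometric series `₁φ̃₁(0;b;q,w)`. -/
noncomputable def phiT (q b w : ℂ) : ℂ :=
  ∑' k : ℕ, qpInf q (b * q ^ k) * (-1) ^ k * q ^ (k * (k - 1) / 2) * w ^ k / qp q q k

/-- The eigenvector components `v_{m,j}`. -/
noncomputable def vmj (q α : ℝ) (m j : ℤ) : ℂ :=
  (-1) ^ j * (α : ℂ) ^ (-j) * (q : ℂ) ^ (j * (j + 1) / 2) *
    phiT (q : ℂ) ((q : ℂ) ^ (j - m + 1)) ((α : ℂ) ^ (-2 : ℤ) * (q : ℂ) ^ (m + j + 1))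

lemma hasSum_sq_tsum_fiber {X ι : Type*} [DecidableEq ι] (d : X → ι) {h : X → ℂ}
    (hh : Summable fun x => ‖h x‖) :
    HasSum (fun i => (∑' x, if d x = i then h x else 0) ^ 2)
      (∑' p : X × X, if d p.1 = d p.2 then h p.1 * h p.2 else 0) := by
  have hprod : Summable fun p : X × X => h p.1 * h p.2 := summable_mul_of_summable_norm hh hh
  have hS : Summable fun p : X × X => if d p.1 = d p.2 then h p.1 * h p.2 else 0 := by
    refine (hprod.indicator {p | d p.1 = d p.2}).congr fun p => ?_
    simp [Set.indicator_apply]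
  convert hS.hasSum.tsum_fiberwise (fun p => d p.1) using 1
  · rfl
  funext i
  have hi : Summable fun x => ‖if d x = i then h x else 0‖ := by
    refine hh.of_nonneg_of_le (fun _ => norm_nonneg _) fun x => ?_
    split_ifs <;> simp
  rw [sq, tsum_mul_tsum_of_summable_norm hi hi,
    tsum_subtype ((fun p : X × X => d p.1) ⁻¹' {i})
      (fun p => if d p.1 = d p.2 then h p.1 * h p.2 else 0)]
  refine tsum_congr fun p => ?_
  by_cases h1 : d p.1 = i
  · by_cases h2 : d p.2 = i
    · simp [h1, h2]
    · simp [h1, h2, Ne.symm h2]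
  · simp [h1]

/-- The coefficients of the product of the Laurent series `∑ f a z ^ a` and `∑ g b z ^ (-b)`. -/
noncomputable def laurentConv (f g : ℕ → ℂ) (i : ℤ) : ℂ :=
  ∑' b : ℕ, if 0 ≤ i + b then f (i + b).toNat * g b else 0

lemma tsum_sub_fiber {f g : ℕ → ℂ} (hf : Summable fun n => ‖f n‖) (hg : Summable fun n => ‖g n‖)
    (i : ℤ) :
    (∑' x : ℕ × ℕ, if (x.1 : ℤ) - x.2 = i then f x.1 * g x.2 else 0) = laurentConv f g i := by
  have hS : Summable fun x : ℕ × ℕ => if (x.1 : ℤ) - x.2 = i then f x.1 * g x.2 else 0 := by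
    refine ((summable_mul_of_summable_norm hf hg).indicator {x | (x.1 : ℤ) - x.2 = i}).congr
      fun x => ?_
    simp [Set.indicator_apply]
  rw [← (Equiv.prodComm ℕ ℕ).tsum_eq]
  refine (Summable.tsum_prod ((Equiv.prodComm ℕ ℕ).summable_iff.2 hS)).trans ?_
  refine tsum_congr fun b => ?_
  by_cases hb : 0 ≤ i + b
  · rw [tsum_eq_single (i + b).toNat]
    · simp [hb]
    · intro a ha
      have : ¬ ((a : ℤ) - b = i) := by omega
      simp [this]
  · have : ∀ a : ℕ, ¬ ((a : ℤ) - b = i) := by intro a; omega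
    simp [hb, this]

lemma tsum_add_fiber (f g : ℕ → ℂ) (n : ℕ) :
    (∑' x : ℕ × ℕ, if x.1 + x.2 = n then f x.1 * g x.2 else 0) =
      ∑ p ∈ Finset.HasAntidiagonal.antidiagonal n, f p.1 * g p.2 := by
  rw [tsum_eq_sum (s := Finset.HasAntidiagonal.antidiagonal n)]
  · refine Finset.sum_congr rfl fun p hp => ?_
    rw [if_pos (Finset.HasAntidiagonal.mem_antidiagonal.1 hp)]
  · intro p hp
    rw [if_neg (fun h => hp (Finset.HasAntidiagonal.mem_antidiagonal.2 h))]

/-- The constant term of `F(z) F(1/z)`, for `F(z) = f(z) g(1/z)`, computed as that of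
`(f g)(z) (f g)(1/z)`. -/
lemma hasSum_laurentConv_sq {f g : ℕ → ℂ} (hf : Summable fun n => ‖f n‖)
    (hg : Summable fun n => ‖g n‖) :
    HasSum (fun i : ℤ => laurentConv f g i ^ 2)
      (∑' n : ℕ, (∑ p ∈ Finset.HasAntidiagonal.antidiagonal n, f p.1 * g p.2) ^ 2) := by
  have hh : Summable fun x : ℕ × ℕ => ‖f x.1 * g x.2‖ := hf.mul_norm hg
  have h1 := hasSum_sq_tsum_fiber (fun x : ℕ × ℕ => (x.1 : ℤ) - x.2) hh
  have h2 := hasSum_sq_tsum_fiber (fun x : ℕ × ℕ => x.1 + x.2) hh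
  simp only [tsum_sub_fiber hf hg] at h1
  simp only [tsum_add_fiber] at h2
  rw [h2.tsum_eq]
  convert h1 using 1
  let e : (ℕ × ℕ) × (ℕ × ℕ) ≃ (ℕ × ℕ) × (ℕ × ℕ) :=
    { toFun := fun p => ((p.1.1, p.2.2), (p.2.1, p.1.2))
      invFun := fun p => ((p.1.1, p.2.2), (p.2.1, p.1.2))
      left_inv := fun _ => rfl
      right_inv := fun _ => rfl }
  rw [← e.tsum_eq]
  refine tsum_congr fun p => ?_
  have : (p.1.1 + p.2.2 = p.2.1 + p.1.2) ↔ ((p.1.1 : ℤ) - p.1.2 = p.2.1 - p.2.2) := by omega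
  simp only [e, Equiv.coe_fn_mk, this]
  split_ifs <;> ring

section QExponential

variable {q : ℂ}

lemma one_sub_pow_succ_ne_zero (hq : ‖q‖ < 1) (n : ℕ) : 1 - q ^ (n + 1) ≠ 0 := by
  intro h
  have h1 : ‖q‖ ^ (n + 1) < 1 := pow_lt_one₀ (norm_nonneg _) hq (by omega)
  rw [← norm_pow, ← sub_eq_zero.1 h, norm_one] at h1
  exact lt_irrefl _ h1

lemma qp_succ (n : ℕ) : qp q q (n + 1) = qp q q n * (1 - q ^ (n + 1)) := by
  rw [qp, Finset.prod_range_succ, ← qp, pow_succ']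

lemma qp_ne_zero (hq : ‖q‖ < 1) (n : ℕ) : qp q q n ≠ 0 := by
  refine Finset.prod_ne_zero_iff.2 fun k _ => ?_
  rw [← pow_succ']
  exact one_sub_pow_succ_ne_zero hq k

lemma qp_mul_qpInf (hq : ‖q‖ < 1) (n : ℕ) :
    qp q q n * qpInf q (q ^ (n + 1)) = qpInf q q := by
  have hm : Multipliable fun k : ℕ => 1 - q * q ^ (k + n) := by
    simp only [sub_eq_add_neg]
    refine multipliable_one_add_of_summable ?_
    have : Summable fun k : ℕ => ‖q‖ ^ k * ‖q‖ ^ (n + 1) :=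
      (summable_geometric_of_lt_one (norm_nonneg _) hq).mul_right _
    refine this.congr fun k => ?_
    rw [norm_neg, norm_mul, norm_pow]
    ring
  have h := hm.prod_mul_tprod_nat_mul' (f := fun k : ℕ => 1 - q * q ^ k)
  rw [qpInf, qp, qpInf, ← h]
  congr 1
  refine tprod_congr fun k => ?_
  ring

lemma qpInf_zpow_eq_zero (hq0 : q ≠ 0) {i : ℤ} (hi : i ≤ 0) : qpInf q (q ^ i) = 0 := by
  refine tprod_of_exists_eq_zero ⟨(-i).toNat, ?_⟩
  rw [← zpow_natCast, ← zpow_add₀ hq0, show i + ((-i).toNat : ℤ) = 0 by omega]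
  simp

/-- The coefficients of `1 / (x; q)_∞`. -/
noncomputable def qexpSmall (q : ℂ) (n : ℕ) : ℂ := (qp q q n)⁻¹

/-- The coefficients of `(q x; q)_∞`. -/
noncomputable def qexpBig (q : ℂ) (n : ℕ) : ℂ := (-1) ^ n * q ^ (n * (n + 1) / 2) * (qp q q n)⁻¹

lemma succ_mul_succ_div_two (n : ℕ) : (n + 1) * (n + 1 + 1) / 2 = n * (n + 1) / 2 + (n + 1) := by
  rw [show (n + 1) * (n + 1 + 1) = n * (n + 1) + (n + 1) * 2 by ring,
    Nat.add_mul_div_right _ _ two_pos]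

open PowerSeries in
lemma mk_qexpBig_mul_mk_qexpSmall (hq : ‖q‖ < 1) :
    (1 - X) * (mk (qexpBig q) * mk (qexpSmall q)) = (1 : PowerSeries ℂ) := by
  have hE : mk (qexpBig q) = (1 - C q * X) * rescale q (mk (qexpBig q)) := by
    ext n
    rw [sub_mul, one_mul, mul_assoc, map_sub, coeff_C_mul]
    cases n with
    | zero => simp
    | succ n =>
      have h1 := qp_ne_zero hq n
      have h2 := one_sub_pow_succ_ne_zero hq n
      simp only [coeff_mk, coeff_succ_X_mul, coeff_rescale, qexpBig, qp_succ,
        succ_mul_succ_div_two]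
      field_simp
      ring
  have he : (1 - X) * mk (qexpSmall q) = rescale q (mk (qexpSmall q)) := by
    ext n
    rw [sub_mul, one_mul, map_sub]
    cases n with
    | zero => simp
    | succ n =>
      have h1 := qp_ne_zero hq n
      have h2 := one_sub_pow_succ_ne_zero hq n
      simp only [coeff_mk, coeff_succ_X_mul, coeff_rescale, qexpSmall, qp_succ]
      field_simp
      ring
  set D : PowerSeries ℂ := (1 - X) * (mk (qexpBig q) * mk (qexpSmall q)) with hD
  have hX : rescale q (1 - X) = 1 - C q * X := by
    rw [map_sub, map_one, rescale_X]
  have hDq : D = rescale q D := by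
    calc D = mk (qexpBig q) * ((1 - X) * mk (qexpSmall q)) := by rw [hD]; ring
      _ = (1 - C q * X) * rescale q (mk (qexpBig q)) * rescale q (mk (qexpSmall q)) := by
        rw [he, ← hE]
      _ = rescale q D := by rw [hD, map_mul, map_mul, hX]; ring
  ext n
  cases n with
  | zero => simp [hD, qexpBig, qexpSmall, qp]
  | succ n =>
    have h := congrArg (coeff (n + 1)) hDq
    rw [coeff_rescale] at h
    have h2 : (1 - q ^ (n + 1)) * coeff (n + 1) D = 0 := by linear_combination h
    rw [(mul_eq_zero.1 h2).resolve_left (one_sub_pow_succ_ne_zero hq n)]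
    simp

lemma sum_qexpBig_mul_qexpSmall (hq : ‖q‖ < 1) (n : ℕ) :
    ∑ p ∈ Finset.HasAntidiagonal.antidiagonal n, qexpBig q p.1 * qexpSmall q p.2 = 1 := by
  have h1 := mk_qexpBig_mul_mk_qexpSmall hq
  have h2 : PowerSeries.mk (qexpBig q) * PowerSeries.mk (qexpSmall q) = PowerSeries.mk 1 := by
    calc _ = (PowerSeries.mk 1 * (1 - PowerSeries.X)) *
          (PowerSeries.mk (qexpBig q) * PowerSeries.mk (qexpSmall q)) := by
            rw [PowerSeries.mk_one_mul_one_sub_eq_one, one_mul]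
      _ = PowerSeries.mk 1 := by rw [mul_assoc, h1, mul_one]
  simpa [PowerSeries.coeff_mul] using congrArg (PowerSeries.coeff n) h2

variable {s : ℂ}

lemma summable_qexpSmall (hq : ‖q‖ < 1) (hs0 : s ≠ 0) (hs : ‖s‖ < 1) :
    Summable fun n => ‖qexpSmall q n * s ^ n‖ := by
  have hlim : Tendsto (fun n : ℕ => ‖s‖ / ‖1 - q ^ (n + 1)‖) atTop (𝓝 ‖s‖) := by
    have h0 : Tendsto (fun n : ℕ => q ^ (n + 1)) atTop (𝓝 0) :=
      (tendsto_pow_atTop_nhds_zero_of_norm_lt_one hq).comp (tendsto_add_atTop_nat 1)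
    have h1 := (tendsto_const_nhds (x := (1 : ℂ))).sub h0
    have h2 := (tendsto_const_nhds (x := ‖s‖)).div h1.norm (by simp)
    rwa [sub_zero, norm_one, div_one] at h2
  refine summable_of_ratio_test_tendsto_lt_one hs (Eventually.of_forall fun n => ?_)
    (hlim.congr fun n => ?_)
  · exact norm_ne_zero_iff.2 (mul_ne_zero (inv_ne_zero (qp_ne_zero hq n)) (pow_ne_zero n hs0))
  · have h1 := norm_ne_zero_iff.2 (qp_ne_zero hq n)
    have h2 := norm_ne_zero_iff.2 (one_sub_pow_succ_ne_zero hq n)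
    have h3 := norm_ne_zero_iff.2 hs0
    simp only [qexpSmall, qp_succ, norm_norm, norm_mul, norm_inv, norm_pow, pow_succ]
    field_simp

lemma summable_qexpBig (hq : ‖q‖ < 1) (hs0 : s ≠ 0) (hs : ‖s‖ < 1) :
    Summable fun n => ‖qexpBig q n * s ^ n‖ := by
  refine (summable_qexpSmall hq hs0 hs).of_nonneg_of_le (fun _ => norm_nonneg _) fun n => ?_
  rw [qexpBig, mul_assoc, ← qexpSmall, norm_mul]
  refine mul_le_of_le_one_left (norm_nonneg _) ?_
  simpa using pow_le_one₀ (norm_nonneg q) hq.le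

lemma hasSum_laurentConv_qexp_sq (hq : ‖q‖ < 1) (hs0 : s ≠ 0) (hs : ‖s‖ < 1) :
    HasSum (fun i : ℤ => laurentConv (fun n => qexpBig q n * s ^ n)
      (fun n => qexpSmall q n * s ^ n) i ^ 2) (1 - s ^ 2)⁻¹ := by
  convert hasSum_laurentConv_sq (summable_qexpBig hq hs0 hs) (summable_qexpSmall hq hs0 hs) using 1
  have hs2 : ‖s ^ 2‖ < 1 := by
    rw [norm_pow]
    exact pow_lt_one₀ (norm_nonneg _) hs two_ne_zero
  rw [← tsum_geometric_of_norm_lt_one hs2]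
  refine tsum_congr fun n => ?_
  have : ∑ p ∈ Finset.HasAntidiagonal.antidiagonal n, qexpBig q p.1 * s ^ p.1 * (qexpSmall q p.2 * s ^ p.2) =
      s ^ n := by
    rw [← one_mul (s ^ n), ← sum_qexpBig_mul_qexpSmall hq n, Finset.sum_mul]
    refine Finset.sum_congr rfl fun p hp => ?_
    rw [← Finset.HasAntidiagonal.mem_antidiagonal.1 hp, pow_add]
    ring
  rw [this]
  ring

lemma int_triangle_add (i m : ℤ) :
    (i + m) * (i + m + 1) / 2 = i * (i + 1) / 2 + m * (m + 1) / 2 + i * m := by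
  have h1 := Int.ediv_mul_cancel (Int.even_mul_succ_self i).two_dvd
  have h2 := Int.ediv_mul_cancel (Int.even_mul_succ_self m).two_dvd
  have h3 := Int.ediv_mul_cancel (Int.even_mul_succ_self (i + m)).two_dvd
  refine mul_right_cancel₀ (two_ne_zero (α := ℤ)) ?_
  linear_combination h3 - h1 - h2

lemma int_triangle_sub (n b : ℕ) :
    ((n : ℤ) - b) * ((n : ℤ) - b + 1) / 2 + ((b * (b - 1) / 2 : ℕ) : ℤ) + ((n : ℤ) - b + 1) * b =
      ((n * (n + 1) / 2 : ℕ) : ℤ) := by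
  have h1 := Int.ediv_mul_cancel (Int.even_mul_succ_self ((n : ℤ) - b)).two_dvd
  have h2 : ((b * (b - 1) / 2 : ℕ) : ℤ) * 2 = b * (b - 1) := by
    have h := Nat.div_mul_cancel (Nat.even_mul_pred_self b).two_dvd
    have hb : ((b * (b - 1) : ℕ) : ℤ) = b * (b - 1) := by cases b <;> simp
    rw [← hb, ← h]
    push_cast
    omega
  have h3 : ((n * (n + 1) / 2 : ℕ) : ℤ) * 2 = n * (n + 1) := by
    exact_mod_cast Nat.div_mul_cancel (Nat.even_mul_succ_self n).two_dvd
  refine mul_right_cancel₀ (two_ne_zero (α := ℤ)) ?_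
  linear_combination h1 + h2 - h3

lemma phiT_eq_laurentConv (hq0 : q ≠ 0) (hq : ‖q‖ < 1) (hs0 : s ≠ 0) (i : ℤ) :
    (-1) ^ i * s ^ i * q ^ (i * (i + 1) / 2) * phiT q (q ^ (i + 1)) (s ^ 2 * q ^ (i + 1)) =
      qpInf q q * laurentConv (fun n => qexpBig q n * s ^ n) (fun n => qexpSmall q n * s ^ n) i := by
  rw [phiT, laurentConv, ← tsum_mul_left, ← tsum_mul_left]
  refine tsum_congr fun b => ?_
  rw [← zpow_natCast q b, ← zpow_add₀ hq0]
  split_ifs with hb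
  · obtain ⟨n, hn⟩ := Int.eq_ofNat_of_zero_le hb
    obtain rfl : i = n - b := by omega
    have hn1 : qp q q n ≠ 0 := qp_ne_zero hq n
    rw [show (n : ℤ) - b + 1 + b = ((n + 1 : ℕ) : ℤ) by push_cast; ring, zpow_natCast,
      ← qp_mul_qpInf hq n, show ((n : ℤ) - b + b).toNat = n by omega]
    have hexp : q ^ (((n : ℤ) - b) * ((n : ℤ) - b + 1) / 2) * q ^ (b * (b - 1) / 2) *
        (q ^ ((n : ℤ) - b + 1)) ^ b = q ^ (n * (n + 1) / 2) := by
      rw [← zpow_natCast (q ^ ((n : ℤ) - b + 1)), ← zpow_mul, ← zpow_natCast q (b * (b - 1) / 2),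
        ← zpow_natCast q (n * (n + 1) / 2), ← zpow_add₀ hq0, ← zpow_add₀ hq0, int_triangle_sub]
    rw [qexpBig, qexpSmall, ← hexp, zpow_sub₀ hs0, zpow_sub₀ (by norm_num : (-1 : ℂ) ≠ 0), mul_pow]
    simp only [zpow_natCast]
    have hsign : ((-1 : ℂ) ^ b) ≠ 0 := pow_ne_zero _ (by norm_num)
    field_simp
    ring
  · rw [qpInf_zpow_eq_zero hq0 (by omega)]
    simp

end QExponential

lemma vmj_eq_laurentConv {q α : ℝ} (hq0 : 0 < q) (hq1 : q < 1) (hα : α ≠ 0) (m j : ℤ) :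
    vmj q α m j = qpInf (q : ℂ) q * (-1) ^ m * (α : ℂ) ^ (-m) * (q : ℂ) ^ (m * (m + 1) / 2) *
      laurentConv (fun n => qexpBig q n * ((α : ℂ)⁻¹ * (q : ℂ) ^ m) ^ n)
        (fun n => qexpSmall q n * ((α : ℂ)⁻¹ * (q : ℂ) ^ m) ^ n) (j - m) := by
  have hq0' : (q : ℂ) ≠ 0 := by exact_mod_cast hq0.ne'
  have hα' : (α : ℂ) ≠ 0 := by exact_mod_cast hα
  have hq : ‖(q : ℂ)‖ < 1 := by rwa [Complex.norm_real, Real.norm_of_nonneg hq0.le]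
  obtain ⟨i, rfl⟩ : ∃ i, j = i + m := ⟨j - m, by ring⟩
  have h := phiT_eq_laurentConv hq0' hq
    (mul_ne_zero (inv_ne_zero hα') (zpow_ne_zero m hq0')) i
  have hw : ((α : ℂ)⁻¹ * (q : ℂ) ^ m) ^ 2 * (q : ℂ) ^ (i + 1) =
      (α : ℂ) ^ (-2 : ℤ) * (q : ℂ) ^ (m + (i + m) + 1) := by
    rw [show m + (i + m) + 1 = m + m + (i + 1) by ring, zpow_add₀ hq0' (m + m), zpow_add₀ hq0' m,
      zpow_neg]
    norm_cast
    ring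
  rw [add_sub_cancel_right, vmj, add_sub_cancel_right, ← hw, int_triangle_add,
    zpow_add₀ hq0', zpow_add₀ hq0', neg_add, zpow_add₀ hα', zpow_add₀ (by norm_num : (-1 : ℂ) ≠ 0)]
  rw [mul_zpow, ← zpow_mul, inv_zpow, ← zpow_neg, mul_comm m i] at h
  linear_combination (-1) ^ m * (α : ℂ) ^ (-m) * (q : ℂ) ^ (m * (m + 1) / 2) * h

theorem stmt_17 (q : ℝ) (hq0 : 0 < q) (hq1 : q < 1) (α : ℝ) (hα : α ≠ 0) (m : ℤ)
    (hm : q ^ m < |α|) :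
    HasSum (fun j : ℤ => (vmj q α m j) ^ 2)
      (qpInf (q : ℂ) (q : ℂ) ^ 2 * (α : ℂ) ^ (-2 * m) * (q : ℂ) ^ (m * (m + 1)) /
        (1 - (α : ℂ) ^ (-2 : ℤ) * (q : ℂ) ^ (2 * m))) := by
  have hq0' : (q : ℂ) ≠ 0 := by exact_mod_cast hq0.ne'
  have hα' : (α : ℂ) ≠ 0 := by exact_mod_cast hα
  have hq : ‖(q : ℂ)‖ < 1 := by rwa [Complex.norm_real, Real.norm_of_nonneg hq0.le]
  have hs : ‖(α : ℂ)⁻¹ * (q : ℂ) ^ m‖ < 1 := by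
    rw [norm_mul, norm_inv, norm_zpow, Complex.norm_real, Complex.norm_real,
      Real.norm_of_nonneg hq0.le, Real.norm_eq_abs, inv_mul_lt_one₀ (abs_pos.2 hα)]
    exact hm
  have h := hasSum_laurentConv_qexp_sq hq (mul_ne_zero (inv_ne_zero hα') (zpow_ne_zero m hq0')) hs
  have h2 := ((Equiv.subRight m).hasSum_iff.2 h).mul_left
    ((qpInf (q : ℂ) q * (-1) ^ m * (α : ℂ) ^ (-m) * (q : ℂ) ^ (m * (m + 1) / 2)) ^ 2)
  convert h2 using 1
  · rfl
  · funext j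
    rw [vmj_eq_laurentConv hq0 hq1 hα, mul_pow]
    rfl
  · have hsign : ((-1 : ℂ) ^ m) ^ 2 = 1 := by
      rw [← zpow_natCast, ← zpow_mul, mul_comm, zpow_mul]
      norm_num
    have hpow : ((q : ℂ) ^ (m * (m + 1) / 2)) ^ 2 = (q : ℂ) ^ (m * (m + 1)) := by
      rw [← zpow_natCast, ← zpow_mul]
      congr 1
      exact Int.ediv_mul_cancel (Int.even_mul_succ_self m).two_dvd
    have hα2 : ((α : ℂ) ^ (-m)) ^ 2 = (α : ℂ) ^ (-2 * m) := by
      rw [← zpow_natCast, ← zpow_mul]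
      congr 1
      push_cast
      ring
    have hden : ((α : ℂ)⁻¹ * (q : ℂ) ^ m) ^ 2 = (α : ℂ) ^ (-2 : ℤ) * (q : ℂ) ^ (2 * m) := by
      rw [mul_pow, ← zpow_natCast ((q : ℂ) ^ m), ← zpow_mul, mul_comm m, zpow_neg, inv_pow]
      norm_cast
    rw [mul_pow, mul_pow, mul_pow, hsign, hpow, hα2, hden, mul_one, div_eq_mul_inv]
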